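/- Let G be a digraph with transitive closure Ḡ, let f̄ be a discrete Morse function on Ḡ, with V̄ = grad f̄ and Φ̄ = Id + ∂V̄ + V̄∂ on Ḡ. Suppose Ω_*(G) is V̄-invariant (V̄(Ω_n(G)) ⊆ Ω_{n+1}(G) for all n) and Φ̄(α) ∈ Ω(G) for every allowed elementary path α on G that is critical in Ḡ. Let T_n : Crit_n(Ḡ) ∩ P_n(G) → P_n^Φ̄(Ḡ) ∩ Ω_n(G) be the linear isomorphism α ↦ α + V̄∂(α), and set ∂̃_n = T_{n−1}^{−1} ∘ ∂_n ∘ T_n. Then ∂̃_n maps Crit_n(Ḡ) ∩ P_n(G) into Crit_{n−1}(Ḡ) ∩ P_{n−1}(G) and ∂̃_{n} ∘ ∂̃_{n+1} = 0, so ({Crit_n(Ḡ) ∩ P_n(G)}, ∂̃) is a chain complex. -/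

import Mathlib

open scoped BigOperators Classical

namespace PathMorse

/-- A digraph: an irreflexive edge relation on a vertex set. -/
structure Digraph (V : Type) where
  E : V → V → Prop
  irrefl : ∀ v, ¬ E v v

/-- A digraph is transitive if `u→v` and `v→w` imply `u→w`. -/
def Digraph.Transitive {V : Type} (G : Digraph V) : Prop :=
  ∀ u v w, G.E u v → G.E v w → G.E u w

/-- `Gbar` is the transitive closure of `G`: the smallest transitive digraph containing `G`. -/
def IsTransClosure {V : Type} (G Gbar : Digraph V) : Prop :=
  Gbar.Transitive ∧ (∀ u v, G.E u v → Gbar.E u v) ∧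
    ∀ H : Digraph V, H.Transitive → (∀ u v, G.E u v → H.E u v) →
      ∀ u v, Gbar.E u v → H.E u v

/-- An elementary `n`-path on `V`: a sequence of `n+1` vertices. -/
abbrev Path (V : Type) (n : ℕ) := Fin (n+1) → V

/-- An elementary path is allowed on `G` if consecutive vertices are joined by directed edges. -/
def Allowed {V : Type} (G : Digraph V) {n : ℕ} (p : Path V n) : Prop :=
  ∀ i : Fin n, G.E (p i.castSucc) (p i.succ)

/-- The `i`-th face of a path: delete the `i`-th vertex. -/
def face {V : Type} {n : ℕ} (i : Fin (n+2)) (p : Path V (n+1)) : Path V n :=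
  p ∘ i.succAbove

/-- `q` is obtained from `p` by deleting one vertex (the codimension-one relation `q < p`). -/
def IsFace {V : Type} {n : ℕ} (q : Path V n) (p : Path V (n+1)) : Prop :=
  ∃ i : Fin (n+2), face i p = q

/-- Value of `f` on a path: sum of the values at the vertices. -/
def fPath {V : Type} (f : V → ℝ) {n : ℕ} (p : Path V n) : ℝ :=
  ∑ i, f (p i)

/-- There is an allowed coface `γ > p` with `f γ = f p`. -/
def HasEqualCoface {V : Type} (G : Digraph V) (f : V → ℝ) {n : ℕ} (p : Path V n) : Prop :=
  ∃ γ : Path V (n+1), Allowed G γ ∧ IsFace p γ ∧ fPath f γ = fPath f p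

/-- There is an allowed face `β < p` with `f β = f p`. -/
def HasEqualFace {V : Type} (G : Digraph V) (f : V → ℝ) : (n : ℕ) → Path V n → Prop
  | 0, _ => False
  | (n+1), p => ∃ β : Path V n, Allowed G β ∧ IsFace β p ∧ fPath f β = fPath f p

/-- A discrete Morse function on a digraph: nonnegative, and for each allowed elementary path
there is at most one allowed coface with the same value, and at most one allowed face with the
same value. -/
def IsMorse {V : Type} (G : Digraph V) (f : V → ℝ) : Prop :=
  (∀ v, 0 ≤ f v) ∧
  (∀ n (α : Path V n), Allowed G α →
    ∀ γ₁ γ₂ : Path V (n+1), Allowed G γ₁ → Allowed G γ₂ → IsFace α γ₁ → IsFace α γ₂ →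
      fPath f γ₁ = fPath f α → fPath f γ₂ = fPath f α → γ₁ = γ₂) ∧
  (∀ n (α : Path V (n+1)), Allowed G α →
    ∀ β₁ β₂ : Path V n, Allowed G β₁ → Allowed G β₂ → IsFace β₁ α → IsFace β₂ α →
      fPath f β₁ = fPath f α → fPath f β₂ = fPath f α → β₁ = β₂)

/-- A critical path: allowed, with no allowed coface of equal value, no allowed face of equal value. -/
def IsCritical {V : Type} (G : Digraph V) (f : V → ℝ) {n : ℕ} (p : Path V n) : Prop :=
  Allowed G p ∧ ¬ HasEqualCoface G f p ∧ ¬ HasEqualFace G f n p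

/-- `n`-chains: the real vector space with (orthonormal) basis the elementary `n`-paths. -/
abbrev Chain (V : Type) (n : ℕ) := Path V n → ℝ

variable {V : Type} [Fintype V] [DecidableEq V]

/-- The basis chain corresponding to an elementary path. -/
def unitP {n : ℕ} (p : Path V n) : Chain V n := Pi.single p 1

/-- The boundary operator on chains (as a bare function). -/
def boundaryFun {n : ℕ} (x : Chain V (n+1)) : Chain V n :=
  fun q => ∑ p : Path V (n+1), x p * ∑ i : Fin (n+2), ((-1:ℝ)^(i:ℕ)) * (if face i p = q then 1 else 0)

/-- The boundary operator `∂ = Σ (-1)^i d_i` as a linear map. -/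
def boundary (V : Type) [Fintype V] [DecidableEq V] (n : ℕ) : Chain V (n+1) →ₗ[ℝ] Chain V n where
  toFun := boundaryFun
  map_add' x y := by
    funext q
    simp [boundaryFun, add_mul, Finset.sum_add_distrib]
  map_smul' c x := by
    funext q
    simp [boundaryFun, Finset.mul_sum, mul_assoc]

/-- `P_n(G)`: the span of the allowed elementary `n`-paths. -/
def pSpan (G : Digraph V) (n : ℕ) : Submodule ℝ (Chain V n) :=
  Submodule.span ℝ {x : Chain V n | ∃ p : Path V n, Allowed G p ∧ x = unitP p}

/-- `Ω_n(G) = {x ∈ P_n(G) : ∂x ∈ P_{n-1}(G)}` (with `Ω_0 = P_0`). -/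
def omega (G : Digraph V) : (n : ℕ) → Submodule ℝ (Chain V n)
  | 0 => pSpan G 0
  | (n+1) => pSpan G (n+1) ⊓ (pSpan G n).comap (boundary V n)

/-- The discrete gradient vector field on a basis path: `V(α) = -⟨∂γ,α⟩ γ` if there is an
allowed coface `γ > α` with `f γ = f α`, and `0` otherwise. -/
noncomputable def gradFun (G : Digraph V) (f : V → ℝ) {n : ℕ} (α : Path V n) : Chain V (n+1) :=
  if h : Allowed G α ∧ ∃ γ : Path V (n+1), Allowed G γ ∧ IsFace α γ ∧ fPath f γ = fPath f α then
    (-(boundary V n (unitP h.2.choose) α)) • unitP h.2.choose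
  else 0

/-- The discrete gradient vector field `V = grad f`, extended linearly to chains. -/
noncomputable def grad (G : Digraph V) (f : V → ℝ) (n : ℕ) : Chain V n →ₗ[ℝ] Chain V (n+1) where
  toFun x := ∑ α : Path V n, x α • gradFun G f α
  map_add' x y := by simp [add_smul, Finset.sum_add_distrib]
  map_smul' c x := by simp [Finset.smul_sum, smul_smul]

/-- The composite `V∂` in degree `n` (zero in degree `0`). -/
noncomputable def vd (G : Digraph V) (f : V → ℝ) : (n : ℕ) → (Chain V n →ₗ[ℝ] Chain V n)
  | 0 => 0
  | (n+1) => (grad G f n).comp (boundary V n)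

/-- The discrete gradient flow `Φ = Id + ∂V + V∂`. -/
noncomputable def flow (G : Digraph V) (f : V → ℝ) (n : ℕ) : Chain V n →ₗ[ℝ] Chain V n :=
  LinearMap.id + (boundary V n).comp (grad G f n) + vd G f n

/-- `P_n^Φ(G) = {x ∈ P_n(G) : Φ x = x}`. -/
noncomputable def pPhi (G : Digraph V) (f : V → ℝ) (n : ℕ) : Submodule ℝ (Chain V n) :=
  pSpan G n ⊓ LinearMap.ker (flow G f n - LinearMap.id)

/-- The cycles of a chain complex of subspaces `C` with differentials `D`
(in degree `0`, everything is a cycle). -/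
def cycles (C : ∀ n, Submodule ℝ (Chain V n)) (D : ∀ n, Chain V (n+1) →ₗ[ℝ] Chain V n) :
    (m : ℕ) → Submodule ℝ (Chain V m)
  | 0 => C 0
  | (m+1) => C (m+1) ⊓ LinearMap.ker (D m)

/-- Homology of the chain complex `(C, D)`: cycles modulo boundaries coming from `C`. -/
abbrev Homology (C : ∀ n, Submodule ℝ (Chain V n)) (D : ∀ n, Chain V (n+1) →ₗ[ℝ] Chain V n)
    (m : ℕ) :=
  (cycles C D m) ⧸ (Submodule.comap (cycles C D m).subtype ((C (m+1)).map (D m)))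

/-- The operator `e^{tf}` on chains. -/
noncomputable def expOp (f : V → ℝ) (t : ℝ) (n : ℕ) : Chain V n →ₗ[ℝ] Chain V n where
  toFun x := fun p => Real.exp (t * fPath f p) * x p
  map_add' x y := by funext p; simp [mul_add]
  map_smul' c x := by funext p; simp; ring

/-- The deformed boundary `∂_t = e^{tf} ∂ e^{-tf}`. -/
noncomputable def dT (f : V → ℝ) (t : ℝ) (n : ℕ) : Chain V (n+1) →ₗ[ℝ] Chain V n :=
  (expOp f t n).comp ((boundary V n).comp (expOp f (-t) (n+1)))

/-- The span of the elementary `n`-paths that are critical in `Gbar` and allowed in `G`. -/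
def critSpan (G Gbar : Digraph V) (f : V → ℝ) (n : ℕ) : Submodule ℝ (Chain V n) :=
  Submodule.span ℝ {x : Chain V n | ∃ α : Path V n, IsCritical Gbar f α ∧ Allowed G α ∧ x = unitP α}

section Paths

variable {V : Type} {G : Digraph V} {f : V → ℝ} {n : ℕ}

theorem Allowed.edge_of_lt (hG : G.Transitive) {p : Path V n} (hp : Allowed G p)
    {i j : Fin (n + 1)} (hij : i < j) : G.E (p i) (p j) := by
  have : IsTrans V G.E := ⟨hG⟩
  exact (Fin.liftFun_iff_succ G.E).2 hp hij

theorem Allowed.injective (hG : G.Transitive) {p : Path V n} (hp : Allowed G p) :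
    Function.Injective p := by
  intro i j hij
  by_contra hne
  rcases lt_or_gt_of_ne hne with h | h
  · exact G.irrefl (p i) (by simpa [hij] using hp.edge_of_lt hG h)
  · exact G.irrefl (p i) (by simpa [hij] using hp.edge_of_lt hG h)

theorem Allowed.face (hG : G.Transitive) {p : Path V (n + 1)} (hp : Allowed G p)
    (i : Fin (n + 2)) : Allowed G (face i p) := fun _ =>
  hp.edge_of_lt hG (Fin.strictMono_succAbove i Fin.castSucc_lt_succ)

theorem face_inj {p : Path V (n + 1)} (hp : Function.Injective p) {i j : Fin (n + 2)}
    (h : face i p = face j p) : i = j := by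
  by_contra hne
  obtain ⟨k, hk⟩ := Fin.exists_succAbove_eq hne
  have hk' := congrFun h k
  simp only [face, Function.comp_apply, hk] at hk'
  exact Fin.succAbove_ne i k (hp hk')

theorem fPath_eq_add_face (f : V → ℝ) (p : Path V (n + 1)) (i : Fin (n + 2)) :
    fPath f p = f (p i) + fPath f (face i p) := by
  simp [fPath, face, Fin.sum_univ_succAbove (fun k => f (p k)) i]

theorem fPath_eq_face_iff (f : V → ℝ) (p : Path V (n + 1)) (i : Fin (n + 2)) :
    fPath f p = fPath f (face i p) ↔ f (p i) = 0 := by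
  rw [fPath_eq_add_face f p i, add_eq_right]

/-- An allowed path of positive length has at most one vertex at which a discrete Morse
function vanishes. -/
theorem IsMorse.zero_index_unique (hf : IsMorse G f) (hG : G.Transitive)
    {p : Path V (n + 1)} (hp : Allowed G p) {i j : Fin (n + 2)}
    (hi : f (p i) = 0) (hj : f (p j) = 0) : i = j :=
  face_inj (hp.injective hG) <| hf.2.2 n p hp _ _ (hp.face hG i) (hp.face hG j) ⟨i, rfl⟩ ⟨j, rfl⟩
    ((fPath_eq_face_iff f p i).2 hi).symm ((fPath_eq_face_iff f p j).2 hj).symm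

theorem IsMorse.not_hasEqualCoface (hf : IsMorse G f) (hG : G.Transitive)
    {p : Path V n} {k : Fin (n + 1)} (hk : f (p k) = 0) : ¬ HasEqualCoface G f p := by
  rintro ⟨γ, hγ, ⟨i, rfl⟩, hfγ⟩
  exact Fin.succAbove_ne i k
    (hf.zero_index_unique hG hγ hk ((fPath_eq_face_iff f γ i).1 hfγ))

theorem hasEqualFace_of_zero (hG : G.Transitive) {p : Path V (n + 1)} (hp : Allowed G p)
    {i : Fin (n + 2)} (hi : f (p i) = 0) : HasEqualFace G f (n + 1) p :=
  ⟨face i p, hp.face hG i, ⟨i, rfl⟩, ((fPath_eq_face_iff f p i).2 hi).symm⟩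

end Paths

section Chains

variable {V : Type} [Fintype V] [DecidableEq V] {G : Digraph V} {f : V → ℝ} {n : ℕ}

theorem chain_eq_sum (x : Chain V n) : x = ∑ p, x p • unitP p := by
  funext q
  simp [unitP, Finset.sum_apply, Pi.single_apply]

theorem chain_hom_ext {M : Type*} [AddCommMonoid M] [Module ℝ M] {A B : Chain V n →ₗ[ℝ] M}
    (h : ∀ p, A (unitP p) = B (unitP p)) : A = B := by
  refine LinearMap.ext fun x => ?_
  rw [chain_eq_sum x]
  simp only [map_sum, map_smul, h]

theorem mem_span_unitP_iff (S : Path V n → Prop) (x : Chain V n) :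
    x ∈ Submodule.span ℝ {x : Chain V n | ∃ p, S p ∧ x = unitP p} ↔ ∀ p, x p ≠ 0 → S p := by
  constructor
  · intro hx
    induction hx using Submodule.span_induction with
    | mem x hx =>
      obtain ⟨p, hp, rfl⟩ := hx
      intro q hq
      by_cases h : q = p
      · exact h ▸ hp
      · simp [unitP, h] at hq
    | zero => simp
    | add x y _ _ hx hy =>
      intro q hq
      by_cases h : x q = 0
      · exact hy q fun h' => hq (by simp [h, h'])
      · exact hx q h
    | smul c x _ hx => exact fun q hq => hx q fun h => hq (by simp [h])
  · intro h
    rw [chain_eq_sum x]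
    refine Submodule.sum_mem _ fun p _ => ?_
    by_cases hp : x p = 0
    · simp [hp]
    · exact Submodule.smul_mem _ _ (Submodule.subset_span ⟨p, h p hp, rfl⟩)

theorem mem_pSpan_iff (x : Chain V n) : x ∈ pSpan G n ↔ ∀ p, x p ≠ 0 → Allowed G p :=
  mem_span_unitP_iff _ x

theorem mem_critSpan_iff {Gbar : Digraph V} (x : Chain V n) :
    x ∈ critSpan G Gbar f n ↔ ∀ p, x p ≠ 0 → IsCritical Gbar f p ∧ Allowed G p := by
  simpa only [critSpan, and_assoc] using
    mem_span_unitP_iff (fun p => IsCritical Gbar f p ∧ Allowed G p) x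

theorem boundary_unitP (p : Path V (n + 1)) :
    boundary V n (unitP p) = ∑ i : Fin (n + 2), (-1 : ℝ) ^ (i : ℕ) • unitP (face i p) := by
  funext q
  simp [boundary, boundaryFun, unitP, Pi.single_apply, Finset.sum_apply, eq_comm]

theorem boundary_boundary (x : Chain V (n + 2)) : boundary V n (boundary V (n + 1) x) = 0 := by
  suffices h : boundary V n ∘ₗ boundary V (n + 1) = 0 from LinearMap.congr_fun h x
  refine chain_hom_ext fun p => ?_
  simp only [LinearMap.comp_apply, LinearMap.zero_apply, boundary_unitP, map_sum, map_smul,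
    Finset.smul_sum, smul_smul, ← pow_add]
  rw [← Finset.sum_product']
  refine Finset.sum_involution (fun ij _ => (ij.1.succAbove ij.2, ij.2.predAbove ij.1))
    ?_ ?_ (fun _ _ => Finset.mem_univ _) ?_
  · rintro ⟨i, j⟩ -
    have h : face (j.predAbove i) (face (i.succAbove j) p) = face j (face i p) := by
      funext k
      simp only [face, Function.comp_apply, Fin.succAbove_succAbove_succAbove_predAbove]
    simp only [h, Fin.neg_one_pow_succAbove_add_predAbove, neg_smul, add_neg_cancel]
  · rintro ⟨i, j⟩ - - h
    exact Fin.succAbove_ne i j (congrArg Prod.fst h)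
  · rintro ⟨i, j⟩ -
    simp [Fin.succAbove_succAbove_predAbove, Fin.predAbove_predAbove_succAbove]

theorem grad_unitP (p : Path V n) : grad G f n (unitP p) = gradFun G f p := by
  simp [grad, unitP, Pi.single_apply, ite_smul]

theorem gradFun_eq_zero {p : Path V n} (h : ¬ HasEqualCoface G f p) : gradFun G f p = 0 :=
  dif_neg fun h' => h h'.2

theorem gradFun_face (hf : IsMorse G f) (hG : G.Transitive) {γ : Path V (n + 1)}
    (hγ : Allowed G γ) {i : Fin (n + 2)} (hi : f (γ i) = 0) :
    gradFun G f (face i γ) = -(-1 : ℝ) ^ (i : ℕ) • unitP γ := by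
  have h : Allowed G (face i γ) ∧ ∃ γ' : Path V (n + 1),
      Allowed G γ' ∧ IsFace (face i γ) γ' ∧ fPath f γ' = fPath f (face i γ) :=
    ⟨hγ.face hG i, γ, hγ, ⟨i, rfl⟩, (fPath_eq_face_iff f γ i).2 hi⟩
  have hc : h.2.choose = γ :=
    hf.2.1 n _ h.1 _ _ h.2.choose_spec.1 hγ h.2.choose_spec.2.1 ⟨i, rfl⟩ h.2.choose_spec.2.2
      ((fPath_eq_face_iff f γ i).2 hi)
  have hb : boundary V n (unitP γ) (face i γ) = (-1 : ℝ) ^ (i : ℕ) := by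
    rw [boundary_unitP, Finset.sum_apply, Finset.sum_eq_single i]
    · simp [unitP]
    · intro j _ hj
      have hne : face i γ ≠ face j γ := fun h' => hj (face_inj (hγ.injective hG) h').symm
      simp [unitP, hne]
    · simp
  rw [gradFun, dif_pos h, hc, hb]

theorem gradFun_cases (hf : IsMorse G f) (hG : G.Transitive) (p : Path V n) :
    gradFun G f p = 0 ∨ ∃ γ i, Allowed G γ ∧ f (γ i) = 0 ∧ face i γ = p ∧
      gradFun G f p = -(-1 : ℝ) ^ (i : ℕ) • unitP γ := by
  by_cases h : HasEqualCoface G f p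
  · obtain ⟨γ, hγ, ⟨i, rfl⟩, hfγ⟩ := h
    have hi := (fPath_eq_face_iff f γ i).1 hfγ
    exact Or.inr ⟨γ, i, hγ, hi, rfl, gradFun_face hf hG hγ hi⟩
  · exact Or.inl (gradFun_eq_zero h)

theorem grad_boundary_unitP (hf : IsMorse G f) (hG : G.Transitive) {γ : Path V (n + 1)}
    (hγ : Allowed G γ) {i : Fin (n + 2)} (hi : f (γ i) = 0) :
    grad G f n (boundary V n (unitP γ)) = -unitP γ := by
  simp only [boundary_unitP, map_sum, map_smul, grad_unitP]
  rw [Finset.sum_eq_single i]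
  · rw [gradFun_face hf hG hγ hi, smul_smul, mul_neg, ← mul_pow]
    simp
  · intro j _ hj
    obtain ⟨k, hk⟩ := Fin.exists_succAbove_eq hj.symm
    rw [gradFun_eq_zero (hf.not_hasEqualCoface hG (k := k) (by simpa [face, hk] using hi)),
      smul_zero]
  · simp

theorem grad_boundary_grad (hf : IsMorse G f) (hG : G.Transitive) (x : Chain V n) :
    grad G f n (boundary V n (grad G f n x)) = -grad G f n x := by
  suffices h : grad G f n ∘ₗ boundary V n ∘ₗ grad G f n = -grad G f n from
    LinearMap.congr_fun h x
  refine chain_hom_ext fun p => ?_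
  simp only [LinearMap.comp_apply, LinearMap.neg_apply, grad_unitP]
  rcases gradFun_cases hf hG p with h | ⟨γ, i, hγ, hi, -, h⟩
  · simp [h]
  · rw [h, map_smul, map_smul, grad_boundary_unitP hf hG hγ hi, smul_neg]

theorem grad_apply_of_not_hasEqualFace (hf : IsMorse G f) (hG : G.Transitive) (x : Chain V n)
    {q : Path V (n + 1)} (hq : ¬ HasEqualFace G f (n + 1) q) : grad G f n x q = 0 := by
  rw [chain_eq_sum x]
  simp only [map_sum, map_smul, grad_unitP, Finset.sum_apply, Pi.smul_apply]
  refine Finset.sum_eq_zero fun p _ => ?_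
  rcases gradFun_cases hf hG p with h | ⟨γ, i, hγ, hi, -, h⟩
  · simp [h]
  · have hne : q ≠ γ := fun h' => hq (h' ▸ hasEqualFace_of_zero hG hγ hi)
    simp [h, unitP, hne]

theorem grad_apply_of_zero (hf : IsMorse G f) (hG : G.Transitive) (x : Chain V n)
    {γ : Path V (n + 1)} (hγ : Allowed G γ) {i : Fin (n + 2)} (hi : f (γ i) = 0) :
    grad G f n x γ = -(-1 : ℝ) ^ (i : ℕ) * x (face i γ) := by
  conv_lhs => rw [chain_eq_sum x]
  simp only [map_sum, map_smul, grad_unitP, Finset.sum_apply, Pi.smul_apply]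
  rw [Finset.sum_eq_single (face i γ)]
  · simp [gradFun_face hf hG hγ hi, unitP, mul_comm]
  · intro p _ hp
    rcases gradFun_cases hf hG p with h | ⟨γ', j, hγ', hj, rfl, h⟩
    · simp [h]
    · have hne : γ ≠ γ' := by
        rintro rfl
        exact hp (by rw [hf.zero_index_unique hG hγ hi hj])
      simp [h, unitP, hne]
  · simp

theorem apply_eq_zero_of_grad_eq_zero (hf : IsMorse G f) (hG : G.Transitive) {x : Chain V n}
    (hx : grad G f n x = 0) {p : Path V n} (hp : HasEqualCoface G f p) : x p = 0 := by
  obtain ⟨γ, hγ, ⟨i, rfl⟩, hfγ⟩ := hp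
  have h := grad_apply_of_zero hf hG x hγ ((fPath_eq_face_iff f γ i).1 hfγ)
  rw [hx] at h
  simpa using h

theorem grad_eq_zero_of_mem_critSpan {Gbar : Digraph V} {x : Chain V n}
    (hx : x ∈ critSpan G Gbar f n) : grad Gbar f n x = 0 := by
  rw [chain_eq_sum x, map_sum]
  refine Finset.sum_eq_zero fun p _ => ?_
  by_cases hp : x p = 0
  · simp [hp]
  · rw [map_smul, grad_unitP,
      gradFun_eq_zero ((mem_critSpan_iff x).1 hx p hp).1.2.1, smul_zero]

theorem vd_apply_of_isCritical (hf : IsMorse G f) (hG : G.Transitive) (x : Chain V n)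
    {p : Path V n} (hp : IsCritical G f p) : vd G f n x p = 0 := by
  cases n with
  | zero => rfl
  | succ n => exact grad_apply_of_not_hasEqualFace hf hG _ hp.2.2

theorem vd_unitP_of_hasEqualFace (hf : IsMorse G f) (hG : G.Transitive) {p : Path V n}
    (hp : Allowed G p) (h : HasEqualFace G f n p) : vd G f n (unitP p) = -unitP p := by
  cases n with
  | zero => exact h.elim
  | succ n =>
    obtain ⟨_, -, ⟨i, rfl⟩, hfp⟩ := h
    exact grad_boundary_unitP hf hG hp ((fPath_eq_face_iff f p i).1 hfp.symm)

theorem flow_mem_omega_of_mem_critSpan {Gbar : Digraph V}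
    (hflow : ∀ (n : ℕ) (α : Path V n), Allowed G α → IsCritical Gbar f α →
      flow Gbar f n (unitP α) ∈ omega G n)
    {x : Chain V n} (hx : x ∈ critSpan G Gbar f n) : flow Gbar f n x ∈ omega G n := by
  refine (Submodule.span_le (p := (omega G n).comap (flow Gbar f n))).2 ?_ hx
  rintro _ ⟨α, hα, hαG, rfl⟩
  exact hflow n α hαG hα

/-- A chain in `P_n(G)` killed by both `V̄` and `V̄∂` lies in the image of `y ↦ y + V̄∂y` on the
span of the critical paths. -/
theorem exists_mem_critSpan_add_vd_eq {Gbar : Digraph V} (hf : IsMorse Gbar f)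
    (hG : Gbar.Transitive) (hle : ∀ u v, G.E u v → Gbar.E u v) {w : Chain V n}
    (hw : w ∈ pSpan G n) (hgrad : grad Gbar f n w = 0) (hvd : vd Gbar f n w = 0) :
    ∃ y ∈ critSpan G Gbar f n, y + vd Gbar f n y = w := by
  have hwG := (mem_pSpan_iff w).1 hw
  let y : Chain V n := fun p => if IsCritical Gbar f p then w p else 0
  refine ⟨y, (mem_critSpan_iff y).2 fun p hp => ?_, ?_⟩
  · by_cases hc : IsCritical Gbar f p
    · exact ⟨hc, hwG p (by simpa [y, hc] using hp)⟩
    · simp [y, hc] at hp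
  · have hN : vd Gbar f n (w - y) = -(w - y) := by
      rw [chain_eq_sum (w - y), map_sum, ← Finset.sum_neg_distrib]
      refine Finset.sum_congr rfl fun p _ => ?_
      by_cases hp : (w - y) p = 0
      · simp only [hp, zero_smul, map_zero, neg_zero]
      · have hc : ¬ IsCritical Gbar f p := fun hc => hp (by simp [y, hc])
        have hwp : w p ≠ 0 := by simpa [y, hc] using hp
        have hall : Allowed Gbar p := fun i => hle _ _ (hwG p hwp i)
        have hface : HasEqualFace Gbar f n p := by
          by_contra hno
          exact hc ⟨hall, fun h => hwp (apply_eq_zero_of_grad_eq_zero hf hG hgrad h), hno⟩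
        rw [map_smul, vd_unitP_of_hasEqualFace hf hG hall hface, smul_neg]
    rw [map_sub, hvd, zero_sub, neg_inj] at hN
    rw [hN, add_sub_cancel]

theorem eq_zero_of_add_vd_eq_zero {Gbar : Digraph V} (hf : IsMorse Gbar f)
    (hG : Gbar.Transitive) {z : Chain V n} (hz : z ∈ critSpan G Gbar f n)
    (h : z + vd Gbar f n z = 0) : z = 0 := by
  funext p
  by_contra hp
  have hp' := congrFun h p
  rw [Pi.add_apply, vd_apply_of_isCritical hf hG z ((mem_critSpan_iff z).1 hz p hp).1,
    add_zero] at hp'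
  exact hp hp'

end Chains

/-- Under `V̄`-invariance of `Ω_*(G)` and the flow condition, the conjugated
boundary `∂̃ = T⁻¹ ∘ ∂ ∘ T` (where `T : α ↦ α + V̄∂α`) maps the span of paths critical in `Ḡ`
and allowed in `G` into itself and squares to zero, making it a chain complex. -/
theorem stmt14 {V : Type} [Fintype V] [DecidableEq V] (G Gbar : Digraph V)
    (hcl : IsTransClosure G Gbar) (f : V → ℝ) (hf : IsMorse Gbar f)
    (hinv : ∀ n, ∀ x ∈ omega G n, grad Gbar f n x ∈ omega G (n+1))
    (hflow : ∀ (n : ℕ) (α : Path V n), Allowed G α → IsCritical Gbar f α →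
      flow Gbar f n (unitP α) ∈ omega G n) :
    (∀ n, ∀ x ∈ critSpan G Gbar f (n+1), ∃ y ∈ critSpan G Gbar f n,
        y + vd Gbar f n y = boundary V n (x + vd Gbar f (n+1) x)) ∧
    (∀ n, ∀ x ∈ critSpan G Gbar f (n+2), ∀ y ∈ critSpan G Gbar f (n+1),
      ∀ z ∈ critSpan G Gbar f n,
        y + vd Gbar f (n+1) y = boundary V (n+1) (x + vd Gbar f (n+2) x) →
        z + vd Gbar f n z = boundary V n (y + vd Gbar f (n+1) y) → z = 0) := by
  obtain ⟨hG, hle, -⟩ := hcl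
  refine ⟨fun n x hx => ?_, fun n x _ y _ z hz hxy hyz => ?_⟩
  · have hflowx : flow Gbar f (n + 1) x = x + vd Gbar f (n + 1) x := by
      simp [flow, grad_eq_zero_of_mem_critSpan hx]
    have hΩ := flow_mem_omega_of_mem_critSpan hflow hx
    rw [hflowx] at hΩ
    refine exists_mem_critSpan_add_vd_eq hf hG hle hΩ.2 ?_ ?_
    · simp only [vd, LinearMap.comp_apply, map_add]
      rw [grad_boundary_grad hf hG, add_neg_cancel]
    · cases n with
      | zero => rfl
      | succ n =>
        change grad Gbar f n (boundary V n (boundary V (n + 1) _)) = 0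
        rw [boundary_boundary, map_zero]
  · refine eq_zero_of_add_vd_eq_zero hf hG hz ?_
    rw [hyz, hxy, boundary_boundary]

end PathMorse
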